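/- arXiv:2406.00220 — 2 statements merged into one kernel-verified Lean document; each statement's English description precedes it below -/
import Mathlib

section
/- Let U ⊆ ℝ^d be open and let Y₀, Y₁, …, Y_r be real-analytic vector fields on U. Define real-analytic vector fields on ℝ × U by Z₀(t,x) = (1, −Y₀(x)) and Z_k(t,x) = (0, Y_k(x)) for k = 1,…,r, and let L be the smallest set of analytic vector fields on ℝ × U that contains {Z₀, Z₁, …, Z_r}, is an ℝ-vector subspace, and is closed under Lie bracket. Say the parabolic Hörmander condition holds at x ∈ U if {V(t,x) : V ∈ L} = ℝ^{1+d} for every t ∈ ℝ. Let B ⊆ U and assume: (H1) the parabolic Hörmander condition holds at every x ∈ U \ B; (H2) for every p ∈ B there exist an open neighborhood W ⊆ U of p and a smooth function Φ : W → ℝ with ∇Φ nonvanishing on W, B ∩ W ⊆ Φ⁻¹(0), and an index k ∈ {0,1,…,r} such that the directional derivative (Y_k Φ)(p) ≠ 0. Then the parabolic Hörmander condition holds at every point of U. -/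
/-- The Lie bracket of two vector fields on a normed space:
`[V,W](x) = DW(x)·V(x) − DV(x)·W(x)`. -/
noncomputable def lieBracket {E : Type*} [NormedAddCommGroup E] [NormedSpace ℝ E]
    (V W : E → E) : E → E :=
  fun x => fderiv ℝ W x (V x) - fderiv ℝ V x (W x)

/-- `LieGen S` is the smallest collection of vector fields containing `S` that is an
`ℝ`-vector subspace and is closed under the Lie bracket. -/
inductive LieGen {E : Type*} [NormedAddCommGroup E] [NormedSpace ℝ E]
    (S : Set (E → E)) : (E → E) → Prop
  | base {V : E → E} : V ∈ S → LieGen S V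
  | smul (c : ℝ) {V : E → E} : LieGen S V → LieGen S (c • V)
  | add {V W : E → E} : LieGen S V → LieGen S W → LieGen S (V + W)
  | bracket {V W : E → E} : LieGen S V → LieGen S W → LieGen S (lieBracket V W)

/-- The parabolic Hörmander condition at `x`: for every `t`, the values at `(t,x)` of the
Lie-generated family of the fields `Z k` exhaust `ℝ^{1+d}`. -/
def HormanderAt {d r : ℕ} (Z : Fin (r + 1) → (ℝ × (Fin d → ℝ)) → ℝ × (Fin d → ℝ))
    (x : Fin d → ℝ) : Prop :=
  ∀ t : ℝ, {y : ℝ × (Fin d → ℝ) | ∃ V, LieGen (Set.range Z) V ∧ V (t, x) = y} = Set.univ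

open Set Filter Topology
open scoped ContDiff Nat NNReal ENNReal

lemma aux_fact (m i k : ℕ) : (i + k)! * (m + i)! ≤ i ! * (m + i + k)! := by
  induction k with
  | zero => simp
  | succ k ih =>
    rw [← add_assoc, ← add_assoc, Nat.factorial_succ, Nat.factorial_succ]
    calc (i + k + 1) * (i + k)! * (m + i)! = (i + k + 1) * ((i + k)! * (m + i)!) := by ring
      _ ≤ (m + i + k + 1) * (i ! * (m + i + k)!) := by gcongr; omega
      _ = _ := by ring

lemma aux_fact2 (m i j : ℕ) (h : i ≤ j) : j.choose i * (j - i)! * (m + i)! ≤ (m + j)! := by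
  obtain ⟨k, rfl⟩ := Nat.exists_eq_add_of_le h
  have h1 := aux_fact m i k
  have h2 := Nat.choose_mul_factorial_mul_factorial h
  have h3 : 0 < i ! := Nat.factorial_pos i
  rw [← h2] at h1
  rw [← add_assoc]
  refine le_of_mul_le_mul_left ?_ h3
  calc _ = (i + k).choose i * i ! * (i + k - i)! * (m + i)! := by ring
    _ ≤ _ := h1

lemma aux_fact3 (m i j : ℕ) (h : i ≤ j) : j.choose i * i ! * (m + (j - i))! ≤ (m + j)! := by
  have := aux_fact2 m (j - i) j (Nat.sub_le _ _)
  rwa [Nat.choose_symm h, Nat.sub_sub_self h] at this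

lemma sum_half (j : ℕ) : ∑ i ∈ Finset.range (j + 1), (1 / 2 : ℝ) ^ i ≤ 2 := by
  have := sum_geometric_two_le (j + 1)
  simpa using this

section
variable {E : Type*} [NormedAddCommGroup E] [NormedSpace ℝ E] [CompleteSpace E]

lemma bracket_analytic {V W : E → E} {x : E} (hV : AnalyticAt ℝ V x) (hW : AnalyticAt ℝ W x) :
    AnalyticAt ℝ (lieBracket V W) x := by
  have h1 : ContDiffAt ℝ ω (fderiv ℝ V) x := hV.fderiv.contDiffAt
  have h2 : ContDiffAt ℝ ω (fderiv ℝ W) x := hW.fderiv.contDiffAt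
  have h3 : ContDiffAt ℝ ω (lieBracket V W) x :=
    (h2.clm_apply hV.contDiffAt).sub (h1.clm_apply hW.contDiffAt)
  exact h3.analyticAt

lemma clm_bound {f : E → E →L[ℝ] E} {g : E → E} {s : Set E} (hs : IsOpen s)
    (hf : AnalyticOnNhd ℝ f s) (hg : AnalyticOnNhd ℝ g s) {x : E} (hx : x ∈ s) (j : ℕ) :
    ‖iteratedFDeriv ℝ j (fun y => f y (g y)) x‖ ≤ ∑ i ∈ Finset.range (j + 1),
      (j.choose i : ℝ) * ‖iteratedFDeriv ℝ i f x‖ * ‖iteratedFDeriv ℝ (j - i) g x‖ := by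
  have := norm_iteratedFDerivWithin_clm_apply (n := j) (N := ω)
    hf.contDiffOn_of_completeSpace hg.contDiffOn_of_completeSpace hs.uniqueDiffOn hx (by simp)
  simpa only [iteratedFDerivWithin_of_isOpen _ hs hx] using this

lemma bracket_bound {Z W : E → E} {s : Set E} (hs : IsOpen s)
    (hZ : AnalyticOnNhd ℝ Z s) (hW : AnalyticOnNhd ℝ W s) {x : E} (hx : x ∈ s)
    {M R C : ℝ} (hM : 0 ≤ M) (hR : 0 ≤ R) (hC : 0 ≤ C) (n : ℕ)
    (bZ : ∀ i, ‖iteratedFDeriv ℝ i Z x‖ ≤ M * (R / 2) ^ i * i !)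
    (bW : ∀ i, ‖iteratedFDeriv ℝ i W x‖ ≤ C * R ^ i * (n + i)!) (j : ℕ) :
    ‖iteratedFDeriv ℝ j (lieBracket Z W) x‖ ≤ (4 * M * R * C) * R ^ j * (n + 1 + j)! := by
  have e : iteratedFDeriv ℝ j (lieBracket Z W) x =
      iteratedFDeriv ℝ j (fun y => fderiv ℝ W y (Z y)) x
      - iteratedFDeriv ℝ j (fun y => fderiv ℝ Z y (W y)) x := by
    have h1 : ContDiffAt ℝ ω (fderiv ℝ W) x := (hW.fderiv x hx).contDiffAt
    have h2 : ContDiffAt ℝ ω (fderiv ℝ Z) x := (hZ.fderiv x hx).contDiffAt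
    exact iteratedFDeriv_sub_apply ((h1.clm_apply (hZ x hx).contDiffAt).of_le (by simp))
      ((h2.clm_apply (hW x hx).contDiffAt).of_le (by simp))
  have t1 := clm_bound hs hW.fderiv hZ hx j
  have t2 := clm_bound hs hZ.fderiv hW hx j
  simp only [norm_iteratedFDeriv_fderiv] at t1 t2
  have u1 : ‖iteratedFDeriv ℝ j (fun y => fderiv ℝ W y (Z y)) x‖ ≤
      2 * (C * M * R ^ (j + 1) * (n + 1 + j)!) := by
    refine t1.trans ?_
    calc _ ≤ ∑ i ∈ Finset.range (j + 1),
          (1 / 2 : ℝ) ^ (j - i) * (C * M * R ^ (j + 1) * (n + 1 + j)!) := by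
          refine Finset.sum_le_sum fun i hi => ?_
          have hij : i ≤ j := by simp at hi; omega
          have hf : ((j.choose i : ℝ) * (j - i)! * (n + 1 + i)!) ≤ (n + 1 + j)! := by
            exact_mod_cast aux_fact2 (n + 1) i j hij
          have hp : R ^ (j + 1) = R ^ (i + 1) * R ^ (j - i) := by
            rw [← pow_add]; congr 1; omega
          have hn : n + (i + 1) = n + 1 + i := by ring
          calc _ ≤ (j.choose i : ℝ) * (C * R ^ (i + 1) * (n + (i + 1))!) *
                (M * (R / 2) ^ (j - i) * (j - i)!) := by
                gcongr
                · exact bW _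
                · exact bZ _
            _ = (1 / 2 : ℝ) ^ (j - i) * (C * M * (R ^ (i + 1) * R ^ (j - i)) *
                ((j.choose i : ℝ) * (j - i)! * (n + 1 + i)!)) := by
                rw [hn, div_pow, div_pow]; ring
            _ ≤ _ := by rw [hp]; gcongr
      _ = (∑ i ∈ Finset.range (j + 1), (1 / 2 : ℝ) ^ i) * (C * M * R ^ (j + 1) * (n + 1 + j)!) := by
          rw [← Finset.sum_mul]
          congr 1
          have := Finset.sum_range_reflect (fun i => (1 / 2 : ℝ) ^ i) (j + 1)
          simpa using this
      _ ≤ _ := by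
          gcongr
          exact sum_half j
  have u2 : ‖iteratedFDeriv ℝ j (fun y => fderiv ℝ Z y (W y)) x‖ ≤
      2 * (C * M * R ^ (j + 1) * (n + 1 + j)!) := by
    refine t2.trans ?_
    calc _ ≤ ∑ i ∈ Finset.range (j + 1),
          (1 / 2 : ℝ) ^ i * (C * M * R ^ (j + 1) * (n + 1 + j)!) := by
          refine Finset.sum_le_sum fun i hi => ?_
          have hij : i ≤ j := by simp at hi; omega
          have hf : ((j.choose i : ℝ) * i ! * (n + (j - i))!) ≤ (n + j)! := by
            exact_mod_cast aux_fact3 n i j hij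
          have hf2 : ((i : ℝ) + 1) * (n + j)! ≤ (n + 1 + j)! := by
            have : (i + 1) * (n + j)! ≤ (n + 1 + j)! := by
              rw [show n + 1 + j = n + j + 1 by ring, Nat.factorial_succ]
              gcongr; omega
            exact_mod_cast this
          have hp : R ^ (j + 1) = R ^ (i + 1) * R ^ (j - i) := by
            rw [← pow_add]; congr 1; omega
          calc _ ≤ (j.choose i : ℝ) * (M * (R / 2) ^ (i + 1) * (i + 1)!) *
                (C * R ^ (j - i) * (n + (j - i))!) := by
                gcongr
                · exact bZ _
                · exact bW _
            _ = (1 / 2 : ℝ) ^ (i + 1) * (C * M * (R ^ (i + 1) * R ^ (j - i)) *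
                (((i : ℝ) + 1) * ((j.choose i : ℝ) * i ! * (n + (j - i))!))) := by
                rw [div_pow, div_pow, Nat.factorial_succ]; push_cast; ring
            _ ≤ (1 / 2 : ℝ) ^ i * (C * M * (R ^ (i + 1) * R ^ (j - i)) *
                (((i : ℝ) + 1) * (n + j)!)) := by
                gcongr ?_ * (_ * (_ * ?_))
                exact pow_le_pow_of_le_one (by norm_num) (by norm_num) (by omega)
            _ ≤ _ := by rw [hp]; gcongr
      _ = (∑ i ∈ Finset.range (j + 1), (1 / 2 : ℝ) ^ i) * (C * M * R ^ (j + 1) * (n + 1 + j)!) := by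
          rw [← Finset.sum_mul]
      _ ≤ _ := by
          gcongr
          exact sum_half j
  rw [e]
  refine (norm_sub_le _ _).trans ((add_le_add u1 u2).trans (le_of_eq ?_))
  ring

lemma analytic_bound {f : E → E} {a : E} (hf : AnalyticAt ℝ f a) :
    ∃ ρ > (0 : ℝ), ∃ T ≥ (0 : ℝ), ∃ R > (0 : ℝ), ∀ x ∈ Metric.ball a ρ, ∀ k : ℕ,
      ‖iteratedFDeriv ℝ k f x‖ ≤ T * R ^ k * k ! := by
  obtain ⟨p, r, hp⟩ := hf
  obtain ⟨q, hq0, hq⟩ := ENNReal.lt_iff_exists_nnreal_btwn.1 hp.r_pos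
  have hq0' : 0 < q := by exact_mod_cast hq0
  set ρ : ℝ≥0 := q / 2 with hρ
  have hρ0 : 0 < ρ := by positivity
  have hρr : (ρ + ρ : ℝ≥0∞) < p.radius := by
    refine lt_of_lt_of_le ?_ hp.r_le
    rw [← ENNReal.coe_add, hρ, add_halves]; exact hq
  have hs := p.changeOriginSeries_summable_aux₁ hρr
  set T : ℝ≥0 := ∑' s : Σ k l : ℕ, { s : Finset (Fin (k + l)) // s.card = l },
      ‖p (s.1 + s.2.1)‖₊ * ρ ^ s.2.1 * ρ ^ s.1 with hT
  refine ⟨ρ, hρ0, T, T.2, (ρ : ℝ)⁻¹, by positivity, fun x hx k => ?_⟩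
  obtain ⟨y, rfl⟩ : ∃ y, x = a + y := ⟨x - a, by simp⟩
  have hy : ‖y‖₊ < ρ := by
    rw [← NNReal.coe_lt_coe, coe_nnnorm]
    simpa using hx
  have hyρ : (‖y‖₊ : ℝ≥0∞) < ρ := by exact_mod_cast hy
  have hρr' : (ρ : ℝ≥0∞) < p.radius := lt_of_le_of_lt le_self_add hρr
  have hρr'' : (ρ : ℝ≥0∞) < r := by
    refine lt_of_le_of_lt ?_ hq
    rw [hρ]; exact_mod_cast half_le_self q.2
  have hpy := hp.changeOrigin (hyρ.trans hρr'')
  have b1 : ‖p.changeOrigin y k‖₊ * ρ ^ k ≤ T := by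
    have h1 := p.nnnorm_changeOrigin_le k (hyρ.trans hρr')
    have h2 : ∑' s : Σ l : ℕ, { s : Finset (Fin (k + l)) // s.card = l },
        ‖p (k + s.1)‖₊ * ‖y‖₊ ^ s.1 ≤ ∑' s : Σ l : ℕ, { s : Finset (Fin (k + l)) // s.card = l },
        ‖p (k + s.1)‖₊ * ρ ^ s.1 := by
      refine Summable.tsum_le_tsum (fun s => by gcongr)
        (p.changeOriginSeries_summable_aux₂ (hyρ.trans hρr') k)
        (p.changeOriginSeries_summable_aux₂ hρr' k)
    calc _ ≤ (∑' s : Σ l : ℕ, { s : Finset (Fin (k + l)) // s.card = l },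
        ‖p (k + s.1)‖₊ * ρ ^ s.1) * ρ ^ k := by gcongr; exact h1.trans h2
      _ = ∑' s : Σ l : ℕ, { s : Finset (Fin (k + l)) // s.card = l },
        ‖p (k + s.1)‖₊ * ρ ^ s.1 * ρ ^ k := by rw [NNReal.tsum_mul_right]
      _ ≤ T := by
        have h3 := (NNReal.summable_sigma.1 hs).2
        rw [hT, hs.tsum_sigma' (fun b => (NNReal.summable_sigma.1 hs).1 b)]
        exact h3.le_tsum k (fun _ _ => zero_le)
  have b2 : ‖p.changeOrigin y k‖ ≤ T * (ρ : ℝ)⁻¹ ^ k := by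
    have : ‖p.changeOrigin y k‖ * (ρ : ℝ) ^ k ≤ T := by exact_mod_cast b1
    rw [inv_pow, ← div_eq_mul_inv, le_div_iff₀ (by positivity)]
    exact this
  refine ContinuousMultilinearMap.opNorm_le_bound (by positivity) fun v => ?_
  rw [hpy.iteratedFDeriv_eq_sum_of_completeSpace]
  calc _ ≤ ∑ σ : Equiv.Perm (Fin k), T * (ρ : ℝ)⁻¹ ^ k * ∏ i, ‖v i‖ := by
        refine norm_sum_le_of_le _ fun σ _ => ?_
        refine (ContinuousMultilinearMap.le_opNorm _ _).trans ?_
        rw [Equiv.prod_comp σ (fun i => ‖v i‖)]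
        gcongr
    _ = _ := by
        rw [Finset.sum_const, Finset.card_univ, Fintype.card_perm, Fintype.card_fin, nsmul_eq_mul]
        ring

/-- Uniform factorial bounds for iterated brackets. -/
lemma iter_bound {Z V : E → E} {a : E} (hZ : AnalyticAt ℝ Z a) (hV : AnalyticAt ℝ V a) :
    ∃ ρ > (0 : ℝ), ∃ C ≥ (0 : ℝ), ∃ A > (0 : ℝ), ∀ x ∈ Metric.ball a ρ, ∀ n : ℕ,
      ‖((lieBracket Z)^[n] V) x‖ ≤ C * A ^ n * n ! := by
  obtain ⟨ρ₁, hρ₁, T₁, hT₁, R₁, hR₁, b₁⟩ := analytic_bound hZ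
  obtain ⟨ρ₂, hρ₂, T₂, hT₂, R₂, hR₂, b₂⟩ := analytic_bound hV
  obtain ⟨ρ₃, hρ₃, h₃⟩ := hZ.exists_ball_analyticOnNhd
  obtain ⟨ρ₄, hρ₄, h₄⟩ := hV.exists_ball_analyticOnNhd
  set ρ := min (min ρ₁ ρ₂) (min ρ₃ ρ₄) with hρ
  have hZs : AnalyticOnNhd ℝ Z (Metric.ball a ρ) :=
    h₃.mono (Metric.ball_subset_ball (by simp [hρ]))
  have hVs : AnalyticOnNhd ℝ V (Metric.ball a ρ) :=
    h₄.mono (Metric.ball_subset_ball (by simp [hρ]))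
  set R := max (2 * R₁) R₂ with hR
  have hR0 : 0 < R := lt_max_of_lt_right hR₂
  set M := T₁ + 1 with hM
  have han : ∀ n, AnalyticOnNhd ℝ ((lieBracket Z)^[n] V) (Metric.ball a ρ) := by
    intro n
    induction n with
    | zero => exact hVs
    | succ n ih =>
      rw [Function.iterate_succ_apply']
      exact fun x hx => bracket_analytic (hZs x hx) (ih x hx)
  refine ⟨ρ, by positivity, T₂, hT₂, 4 * M * R, by positivity, fun x hx n => ?_⟩
  have key : ∀ j, ‖iteratedFDeriv ℝ j ((lieBracket Z)^[n] V) x‖ ≤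
      (T₂ * (4 * M * R) ^ n) * R ^ j * (n + j)! := by
    induction n with
    | zero =>
      intro j
      have := b₂ x (Metric.ball_subset_ball (by simp [hρ]) hx) j
      simp only [Function.iterate_zero, id, pow_zero, mul_one, zero_add]
      refine this.trans ?_
      gcongr
      exact le_max_right _ _
    | succ n ih =>
      intro j
      rw [Function.iterate_succ_apply']
      have := bracket_bound Metric.isOpen_ball hZs (han n) hx (M := M) (R := R)
        (C := T₂ * (4 * M * R) ^ n) (by positivity) hR0.le (by positivity) n ?_ ih j
      · refine this.trans (le_of_eq ?_)
        ring
      · intro i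
        refine (b₁ x (Metric.ball_subset_ball (by simp [hρ]) hx) i).trans ?_
        gcongr
        · linarith
        · have := le_max_left (2 * R₁) R₂
          rw [← hR] at this; linarith
  simpa using key 0
end

lemma choose_le_aux (n k : ℕ) : ((n + k)! : ℝ) ≤ 2 ^ (n + k) * n ! * k ! := by
  have h := Nat.add_choose_mul_factorial_mul_factorial n k
  have h2 : (n + k).choose k ≤ 2 ^ (n + k) := Nat.choose_le_two_pow _ _
  have : (n + k)! ≤ 2 ^ (n + k) * n ! * k ! := by
    rw [← h]; gcongr
  exact_mod_cast this

/-- A family of successive derivatives with analytic bounds, all vanishing at `a`, vanishes. -/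
lemma vanish_right {g : ℕ → ℝ → ℝ} {a b C A : ℝ} (hC : 0 ≤ C) (hA : 0 < A)
    (hd : ∀ n, ∀ s ∈ Icc a b, HasDerivAt (g n) (g (n + 1) s) s)
    (hb : ∀ n, ∀ s ∈ Icc a b, |g n s| ≤ C * A ^ n * n !)
    (h0 : ∀ n, g n a = 0) (hab : A * (b - a) < 1 / 2) :
    ∀ n, ∀ s ∈ Icc a b, g n s = 0 := by
  have key : ∀ k n, ∀ s ∈ Icc a b,
      |g n s| ≤ C * A ^ (n + k) * (n + k)! / k ! * (s - a) ^ k := by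
    intro k
    induction k with
    | zero => intro n s hs; simpa using hb n s hs
    | succ k ih =>
      intro n
      refine image_norm_le_of_norm_deriv_right_le_deriv_boundary (f := g n) (f' := g (n + 1))
        (B := fun s => C * A ^ (n + (k + 1)) * (n + (k + 1))! / (k + 1)! * (s - a) ^ (k + 1))
        (B' := fun s => C * A ^ (n + 1 + k) * (n + 1 + k)! / k ! * (s - a) ^ k)
        (fun s hs => (hd n s hs).continuousAt.continuousWithinAt)
        (fun s hs => (hd n s ⟨hs.1, hs.2.le⟩).hasDerivWithinAt) ?_ ?_ ?_
      · simp [h0]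
      · intro x
        have h1 : HasDerivAt (fun s : ℝ => (s - a) ^ (k + 1)) (((k + 1 : ℕ) : ℝ) * (x - a) ^ k) x := by
          have := ((hasDerivAt_id x).sub_const a).pow (k + 1)
          refine (this.congr_deriv ?_)
          simp
        refine (h1.const_mul _).congr_deriv ?_
        rw [show n + 1 + k = n + (k + 1) by ring, Nat.factorial_succ k]
        have : (k ! : ℝ) ≠ 0 := by positivity
        push_cast
        field_simp
      · intro x hx
        exact ih (n + 1) x ⟨hx.1, hx.2.le⟩
  intro n s hs
  have hle : ∀ k : ℕ, |g n s| ≤ (C * (2 * A) ^ n * n !) * (2 * A * (b - a)) ^ k := by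
    intro k
    have hsa : 0 ≤ s - a := by linarith [hs.1]
    have hba : s - a ≤ b - a := by linarith [hs.2]
    refine (key k n s hs).trans ?_
    calc _ ≤ C * A ^ (n + k) * (2 ^ (n + k) * n ! * k !) / k ! * (b - a) ^ k := by
          gcongr
          exact choose_le_aux n k
      _ = _ := by
          have : (k ! : ℝ) ≠ 0 := by positivity
          rw [mul_pow, mul_pow, mul_pow, pow_add, pow_add]
          field_simp
  have hlim : Tendsto (fun k : ℕ => (C * (2 * A) ^ n * n !) * (2 * A * (b - a)) ^ k) atTop (𝓝 0) := by
    have hba : 0 ≤ b - a := by linarith [hs.1, hs.2]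
    have := tendsto_pow_atTop_nhds_zero_of_lt_one (r := 2 * A * (b - a)) (by positivity) (by linarith)
    simpa using this.const_mul (C * (2 * A) ^ n * n !)
  have := ge_of_tendsto' hlim hle
  exact abs_nonpos_iff.1 this

lemma lieGen_iter {E : Type*} [NormedAddCommGroup E] [NormedSpace ℝ E] {S : Set (E → E)}
    {Z V : E → E} (hZ : Z ∈ S) (hV : LieGen S V) (n : ℕ) : LieGen S ((lieBracket Z)^[n] V) := by
  induction n with
  | zero => exact hV
  | succ n ih =>
    rw [Function.iterate_succ_apply']
    exact LieGen.bracket (LieGen.base hZ) ih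

lemma lieGen_analytic {E : Type*} [NormedAddCommGroup E] [NormedSpace ℝ E] [CompleteSpace E]
    {S : Set (E → E)} {x : E} (hS : ∀ V ∈ S, AnalyticAt ℝ V x) {V : E → E} (hV : LieGen S V) :
    AnalyticAt ℝ V x := by
  induction hV with
  | base h => exact hS _ h
  | smul c _ ih => exact ih.const_smul
  | add _ _ h1 h2 => exact h1.add h2
  | bracket _ _ h1 h2 => exact bracket_analytic h1 h2

lemma propagate {E : Type*} [NormedAddCommGroup E] [NormedSpace ℝ E] [CompleteSpace E]
    {S : Set (E → E)} {O : Set E} (hO : IsOpen O) (hS : ∀ V ∈ S, AnalyticOnNhd ℝ V O)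
    {Z : E → E} (hZ : Z ∈ S) {p : E} (hp : p ∈ O) {l : E →L[ℝ] ℝ} (hl : l ≠ 0)
    (hl0 : ∀ V, LieGen S V → l (V p) = 0) :
    ∃ γ : ℝ → E, γ 0 = p ∧ HasDerivAt γ (Z p) 0 ∧
      ∀ᶠ s in 𝓝[>] (0 : ℝ), ∃ m : E →L[ℝ] ℝ, m ≠ 0 ∧ ∀ V, LieGen S V → m (V (γ s)) = 0 := by
  let F : E × (E →L[ℝ] ℝ) → E × (E →L[ℝ] ℝ) :=
    fun q => (Z q.1, -(q.2.comp (fderiv ℝ Z q.1)))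
  have hZp : AnalyticAt ℝ Z p := hS Z hZ p hp
  have hF : ContDiffAt ℝ 1 F (p, l) := by
    have h1 : ContDiffAt ℝ 1 (fun q : E × (E →L[ℝ] ℝ) => Z q.1) (p, l) :=
      ContDiffAt.comp (p, l) (hZp.contDiffAt (n := 1)) contDiffAt_fst
    have h2 : ContDiffAt ℝ 1 (fun q : E × (E →L[ℝ] ℝ) => fderiv ℝ Z q.1) (p, l) :=
      ContDiffAt.comp (p, l) (hZp.fderiv.contDiffAt (n := 1)) contDiffAt_fst
    exact h1.prodMk ((contDiffAt_snd.clm_comp h2).neg)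
  obtain ⟨α, hα0, ε, hε, hα⟩ :=
    hF.exists_forall_mem_closedBall_exists_eq_forall_mem_Ioo_hasDerivAt₀ 0
  have hα00 : HasDerivAt α (F (p, l)) 0 := by
    have := hα 0 ⟨by linarith, by linarith⟩
    rwa [hα0] at this
  have hev : ∀ᶠ s in 𝓝 (0 : ℝ), (α s).1 ∈ O ∧ (α s).2 ≠ 0 ∧ s ∈ Ioo (0 - ε) (0 + ε) := by
    have hc : ContinuousAt α 0 := hα00.continuousAt
    have c1 : ContinuousAt (fun s => (α s).1) 0 := hc.fst
    have c2 : ContinuousAt (fun s => (α s).2) 0 := hc.snd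
    refine (c1.eventually_mem (hO.mem_nhds (by simpa [hα0] using hp))).and
      ((c2.eventually_ne (by simpa [hα0] using hl)).and
        (Ioo_mem_nhds (by linarith) (by linarith)))
  obtain ⟨δ, hδ, hball⟩ := Metric.eventually_nhds_iff_ball.1 hev
  have hI : ∀ s ∈ Icc (0 : ℝ) (δ / 2), (α s).1 ∈ O ∧ (α s).2 ≠ 0 ∧ HasDerivAt α (F (α s)) s := by
    intro s hs
    obtain ⟨h1, h2, h3⟩ := hball s (by
      rw [Metric.mem_ball, Real.dist_eq, sub_zero, abs_of_nonneg hs.1]; linarith [hs.2])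
    exact ⟨h1, h2, hα s h3⟩
  refine ⟨fun s => (α s).1, by simp [hα0], ?_, ?_⟩
  · exact hα00.fst
  have main : ∀ V, LieGen S V → ∀ s ∈ Icc (0 : ℝ) (δ / 2), (α s).2 (V (α s).1) = 0 := by
    intro V hV
    set g : ℕ → ℝ → ℝ := fun n s => (α s).2 (((lieBracket Z)^[n] V) (α s).1) with hg
    have hd : ∀ n, ∀ s ∈ Icc (0 : ℝ) (δ / 2), HasDerivAt (g n) (g (n + 1) s) s := by
      intro n s hs
      obtain ⟨h1, h2, h3⟩ := hI s hs
      have hW : AnalyticAt ℝ ((lieBracket Z)^[n] V) (α s).1 :=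
        lieGen_analytic (fun V hV => hS V hV _ h1) (lieGen_iter hZ hV n)
      have d1 : HasDerivAt (fun s => (α s).1) (Z (α s).1) s := h3.fst
      have d2 : HasDerivAt (fun s => (α s).2) (-((α s).2.comp (fderiv ℝ Z (α s).1))) s := h3.snd
      have d3 := hW.differentiableAt.hasFDerivAt.comp_hasDerivAt s d1
      have d4 := d2.clm_apply d3
      refine d4.congr_deriv ?_
      simp only [hg, Function.iterate_succ_apply', lieBracket]
      simp
      ring
    set u : Set ℝ := {s | ∀ n, g n s = 0} with hu
    have hsub : Icc (0 : ℝ) (δ / 2) ⊆ u := by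
      refine IsClosed.Icc_subset_of_forall_mem_nhdsWithin ?_ ?_ ?_
      · have : u ∩ Icc (0 : ℝ) (δ / 2) = ⋂ n, (Icc (0 : ℝ) (δ / 2) ∩ g n ⁻¹' {0}) := by
          ext s
          simp only [hu, mem_inter_iff, mem_ofPred_eq, mem_iInter, mem_preimage, mem_singleton_iff]
          exact ⟨fun h n => ⟨h.2, h.1 n⟩, fun h => ⟨fun n => (h n).2, (h 0).1⟩⟩
        rw [this]
        refine isClosed_iInter fun n => ?_
        exact ContinuousOn.preimage_isClosed_of_isClosed
          (fun s hs => (hd n s hs).continuousAt.continuousWithinAt) isClosed_Icc isClosed_singleton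
      · intro n
        simp only [hg, hα0]
        exact hl0 _ (lieGen_iter hZ hV n)
      · rintro x ⟨hxu, hx⟩
        obtain ⟨h1, h2, h3⟩ := hI x ⟨hx.1, hx.2.le⟩
        have hV' : AnalyticAt ℝ V (α x).1 := lieGen_analytic (fun V hV => hS V hV _ h1) hV
        obtain ⟨ρ, hρ, C, hC, A, hA, hb⟩ := iter_bound (hS Z hZ _ h1) hV'
        have hc : ContinuousAt α x := h3.continuousAt
        have c1 : ContinuousAt (fun s => (α s).1) x := hc.fst
        have c2 : ContinuousAt (fun s => ‖(α s).2‖) x := hc.snd.norm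
        have hev2 : ∀ᶠ s in 𝓝 x, (α s).1 ∈ Metric.ball (α x).1 ρ ∧ ‖(α s).2‖ < ‖(α x).2‖ + 1 :=
          (c1.eventually_mem (Metric.ball_mem_nhds _ hρ)).and
            (c2.eventually_lt continuousAt_const (by linarith))
        obtain ⟨η, hη, hball2⟩ := Metric.eventually_nhds_iff_ball.1 hev2
        set c := min (η / 2) (min (δ / 2 - x) (1 / (4 * A))) with hcdef
        have hc0 : 0 < c := by
          have : 0 < δ / 2 - x := by linarith [hx.2]
          positivity
        have hcη : c ≤ η / 2 := min_le_left _ _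
        have hcδ : c ≤ δ / 2 - x := (min_le_right _ _).trans (min_le_left _ _)
        have hcA : c ≤ 1 / (4 * A) := (min_le_right _ _).trans (min_le_right _ _)
        have hsI : ∀ s ∈ Icc x (x + c), s ∈ Icc (0 : ℝ) (δ / 2) := fun s hs =>
          ⟨hx.1.trans hs.1, by linarith [hs.2]⟩
        have hv := vanish_right (g := g) (a := x) (b := x + c) (C := (‖(α x).2‖ + 1) * C) (A := A)
          (by positivity) hA (fun n s hs => hd n s (hsI s hs)) ?_ hxu ?_
        · exact mem_of_superset (Icc_mem_nhdsGT (by linarith)) fun s hs n => hv n s hs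
        · intro n s hs
          obtain ⟨k1, k2⟩ := hball2 s (by
            rw [Metric.mem_ball, Real.dist_eq, abs_of_nonneg (by linarith [hs.1])]
            linarith [hs.2])
          calc |g n s| ≤ ‖(α s).2‖ * ‖((lieBracket Z)^[n] V) (α s).1‖ := by
                rw [← Real.norm_eq_abs]; exact (α s).2.le_opNorm _
            _ ≤ (‖(α x).2‖ + 1) * (C * A ^ n * n !) := by
                gcongr
                exact hb _ k1 n
            _ = _ := by ring
        · have : A * c ≤ A * (1 / (4 * A)) := by gcongr
          have e : A * (1 / (4 * A)) = 1 / 4 := by field_simp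
          rw [add_sub_cancel_left]; linarith
    intro s hs
    exact hsub hs 0
  filter_upwards [Icc_mem_nhdsGT (show (0 : ℝ) < δ / 2 by linarith)] with s hs
  exact ⟨(α s).2, (hI s hs).2.1, fun V hV => main V hV s hs⟩

/-- Let `U ⊆ ℝ^d` be open and `Y₀,…,Y_r` real-analytic vector fields on `U`.
With `Z₀(t,x) = (1, −Y₀(x))` and `Z_k(t,x) = (0, Y_k(x))`, assume
(H1) the parabolic Hörmander condition holds at every `x ∈ U \ B`, and
(H2) each `p ∈ B` has an open neighborhood `W ⊆ U` carrying a smooth `Φ : W → ℝ` with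
nonvanishing gradient, `B ∩ W ⊆ Φ⁻¹(0)`, and `(Y_k Φ)(p) ≠ 0` for some `k`.
Then the parabolic Hörmander condition holds at every point of `U`. -/
theorem statement1 (d r : ℕ) (U : Set (Fin d → ℝ)) (hU : IsOpen U)
    (Y : Fin (r + 1) → (Fin d → ℝ) → (Fin d → ℝ))
    (hY : ∀ k, AnalyticOnNhd ℝ (Y k) U)
    (Z : Fin (r + 1) → (ℝ × (Fin d → ℝ)) → ℝ × (Fin d → ℝ))
    (hZ0 : Z 0 = fun p => ((1 : ℝ), -Y 0 p.2))
    (hZk : ∀ k : Fin (r + 1), k ≠ 0 → Z k = fun p => ((0 : ℝ), Y k p.2))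
    (B : Set (Fin d → ℝ))
    (hH1 : ∀ x ∈ U \ B, HormanderAt Z x)
    (hH2 : ∀ p ∈ B, ∃ W : Set (Fin d → ℝ), IsOpen W ∧ W ⊆ U ∧ p ∈ W ∧
      ∃ Φ : (Fin d → ℝ) → ℝ, ContDiffOn ℝ (⊤ : ℕ∞) Φ W ∧
        (∀ x ∈ W, fderiv ℝ Φ x ≠ 0) ∧
        B ∩ W ⊆ Φ ⁻¹' {0} ∧
        ∃ k : Fin (r + 1), fderiv ℝ Φ p (Y k p) ≠ 0) :
    ∀ x ∈ U, HormanderAt Z x := by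
  classical
  intro x hxU
  by_cases hxB : x ∉ B
  · exact hH1 x ⟨hxU, hxB⟩
  rw [not_not] at hxB
  obtain ⟨W, hWo, hWU, hxW, Φ, hΦ, -, hBW, k, hk⟩ := hH2 x hxB
  intro t
  by_contra hne
  -- the proper subspace of values
  let L : Submodule ℝ (ℝ × (Fin d → ℝ)) :=
    { carrier := {y | ∃ V, LieGen (Set.range Z) V ∧ V (t, x) = y}
      add_mem' := by
        rintro _ _ ⟨V, hV, rfl⟩ ⟨V', hV', rfl⟩
        exact ⟨V + V', LieGen.add hV hV', rfl⟩
      zero_mem' := ⟨(0 : ℝ) • Z 0, LieGen.smul 0 (LieGen.base ⟨0, rfl⟩), by simp⟩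
      smul_mem' := by
        rintro c _ ⟨V, hV, rfl⟩
        exact ⟨c • V, LieGen.smul c hV, rfl⟩ }
  have hL : L < ⊤ := by
    refine lt_top_iff_ne_top.2 fun h => hne ?_
    have : (L : Set (ℝ × (Fin d → ℝ))) = Set.univ := by rw [h]; rfl
    exact this
  obtain ⟨f, hf0, hf⟩ := L.exists_le_ker_of_lt_top hL
  have hl : (LinearMap.toContinuousLinearMap f) ≠ 0 := by
    intro h
    apply hf0
    refine LinearMap.ext fun y => ?_
    exact congrArg (fun m : (ℝ × (Fin d → ℝ)) →L[ℝ] ℝ => m y) h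
  have hO : IsOpen (Prod.snd ⁻¹' U : Set (ℝ × (Fin d → ℝ))) := hU.preimage continuous_snd
  have hYs : ∀ j, AnalyticOnNhd ℝ (fun q : ℝ × (Fin d → ℝ) => Y j q.2) (Prod.snd ⁻¹' U) :=
    fun j q hq => AnalyticAt.comp (hY j q.2 hq) analyticAt_snd
  have hS : ∀ V ∈ Set.range Z, AnalyticOnNhd ℝ V (Prod.snd ⁻¹' U) := by
    rintro _ ⟨j, rfl⟩ q hq
    by_cases hj : j = 0
    · subst hj
      rw [hZ0]
      exact analyticAt_const.prod (hYs 0 q hq).neg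
    · rw [hZk j hj]
      exact analyticAt_const.prod (hYs j q hq)
  obtain ⟨γ, hγ0, hγ, hev⟩ := propagate hO hS (Z := Z k) ⟨k, rfl⟩ (p := (t, x)) hxU hl
    (fun V hV => hf ⟨V, hV, rfl⟩)
  have hγ2 : HasDerivAt (fun s => (γ s).2) (Z k (t, x)).2 0 := hγ.snd
  have hΦx : HasFDerivAt Φ (fderiv ℝ Φ x) (γ 0).2 := by
    rw [hγ0]
    exact ((hΦ.contDiffAt (hWo.mem_nhds hxW)).differentiableAt (by simp)).hasFDerivAt
  have hcomp : HasDerivAt (fun s => Φ (γ s).2) (fderiv ℝ Φ x (Z k (t, x)).2) 0 :=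
    hΦx.comp_hasDerivAt (0 : ℝ) hγ2
  have hnz : fderiv ℝ Φ x (Z k (t, x)).2 ≠ 0 := by
    by_cases hj : k = 0
    · subst hj
      rw [hZ0]
      simpa using hk
    · rw [hZk k hj]
      exact hk
  have e1 : ∀ᶠ s in 𝓝[>] (0 : ℝ), Φ (γ s).2 ≠ 0 :=
    (hcomp.eventually_ne hnz).filter_mono (nhdsWithin_mono _ fun s hs => ne_of_gt hs)
  have e2 : ∀ᶠ s in 𝓝[>] (0 : ℝ), (γ s).2 ∈ W :=
    (hγ2.continuousAt.eventually_mem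
      (hWo.mem_nhds (by simpa [hγ0] using hxW))).filter_mono nhdsWithin_le_nhds
  obtain ⟨s, ⟨m, hm0, hm⟩, hs1, hs2⟩ := (hev.and (e1.and e2)).exists
  have hsB : (γ s).2 ∉ B := fun h => hs1 (hBW ⟨h, hs2⟩)
  have hH := hH1 (γ s).2 ⟨hWU hs2, hsB⟩ (γ s).1
  apply hm0
  refine ContinuousLinearMap.ext fun y => ?_
  have hy : y ∈ {y | ∃ V, LieGen (Set.range Z) V ∧ V ((γ s).1, (γ s).2) = y} := by
    rw [hH]; trivial
  obtain ⟨V, hV, rfl⟩ := hy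
  exact hm V hV
end

section
/- Let w = (x,v) ∈ ℝ³ × ℝ³ with v₁² + v₂² + v₃² = 1 and v₃ ≠ ±1. Then the ℝ-linear span of the fifteen vectors X̃₁(w), X̃₂(w), X̃₃(w), X̃₄(w), X̃₅(w), [X̃₁,X̃₀](w), [X̃₁,[X̃₁,X̃₀]](w), [X̃ₖ,[X̃₁,X̃₀]](w) for k = 2,3,4,5, and [X̃ₖ,[X̃₁,[X̃₁,X̃₀]]](w) for k = 2,3,4,5, equals the 5-dimensional subspace {(a,b) ∈ ℝ³ × ℝ³ : b₁v₁ + b₂v₂ + b₃v₃ = 0} of ℝ⁶. -/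
/-- The phase space `ℝ³ × ℝ³` with coordinates `(x₁,x₂,x₃,v₁,v₂,v₃)`. -/
abbrev E6 : Type := (Fin 3 → ℝ) × (Fin 3 → ℝ)

/-- The drift vector field `X̃₀` of the projective process. -/
noncomputable def Xt0 : E6 → E6 := fun w =>
  let x := w.1; let v := w.2
  let α : ℝ := -(v 2) * v 0 * Real.sin (x 2) + v 2 * v 1 * Real.cos (x 2)
  (![Real.cos (x 2), Real.sin (x 2), 1],
   ![-(v 2) * Real.sin (x 2) - α * v 0, v 2 * Real.cos (x 2) - α * v 1, -(α * v 2)])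

/-- The vector field `X̃₁ = (0,0,1,0,0,0)`. -/
noncomputable def Xt1 : E6 → E6 := fun _ => (![0, 0, 1], ![0, 0, 0])

/-- The common shape of `X̃₂,…,X̃₅`. -/
noncomputable def XtGen (B : (Fin 3 → ℝ) → ℝ) (c : E6 → ℝ) : E6 → E6 := fun w =>
  let v := w.2
  (![0, 0, B w.1],
   ![c w * (-(v 2) * v 0), c w * (-(v 2) * v 1), c w * (1 - (v 2) ^ 2)])

noncomputable def Xt2 : E6 → E6 :=
  XtGen (fun x => Real.sin (x 0)) (fun w => w.2 0 * Real.cos (w.1 0))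

noncomputable def Xt3 : E6 → E6 :=
  XtGen (fun x => Real.cos (x 0)) (fun w => -(w.2 0) * Real.sin (w.1 0))

noncomputable def Xt4 : E6 → E6 :=
  XtGen (fun x => Real.sin (x 1)) (fun w => w.2 1 * Real.cos (w.1 1))

noncomputable def Xt5 : E6 → E6 :=
  XtGen (fun x => Real.cos (x 1)) (fun w => -(w.2 1) * Real.sin (w.1 1))

/-- `e₄(v) = (1/√(1−v₃²))·(−v₃v₁, −v₃v₂, 1−v₃²)`. -/
noncomputable def e₄ (v : Fin 3 → ℝ) : Fin 3 → ℝ :=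
  (Real.sqrt (1 - (v 2) ^ 2))⁻¹ • ![-(v 2) * v 0, -(v 2) * v 1, 1 - (v 2) ^ 2]

/-- `e₅(v) = (1/√(1−v₃²))·(−v₂, v₁, 0)`. -/
noncomputable def e₅ (v : Fin 3 → ℝ) : Fin 3 → ℝ :=
  (Real.sqrt (1 - (v 2) ^ 2))⁻¹ • ![-(v 1), v 0, 0]

/-- The fields `[X̃₁,X̃₀]` and `[X̃₁,[X̃₁,X̃₀]]` have this shape. -/
noncomputable def Qf (C S : ℝ → ℝ) : E6 → E6 := fun w =>
  (![-S (w.1 2), C (w.1 2), 0],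
   ![-(w.2 2) * C (w.1 2) + w.2 2 * (C (w.1 2) * w.2 0 + S (w.1 2) * w.2 1) * w.2 0,
     -(w.2 2) * S (w.1 2) + w.2 2 * (C (w.1 2) * w.2 0 + S (w.1 2) * w.2 1) * w.2 1,
     w.2 2 * (C (w.1 2) * w.2 0 + S (w.1 2) * w.2 1) * w.2 2])

theorem hasFDerivAt_x (w : E6) (i : Fin 3) :
    HasFDerivAt (fun w : E6 => w.1 i)
      ((ContinuousLinearMap.proj (R := ℝ) (φ := fun _ : Fin 3 => ℝ) i).comp
        (ContinuousLinearMap.fst ℝ (Fin 3 → ℝ) (Fin 3 → ℝ))) w :=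
  ContinuousLinearMap.hasFDerivAt
    ((ContinuousLinearMap.proj (R := ℝ) (φ := fun _ : Fin 3 => ℝ) i).comp
        (ContinuousLinearMap.fst ℝ (Fin 3 → ℝ) (Fin 3 → ℝ)))

theorem hasFDerivAt_v (w : E6) (i : Fin 3) :
    HasFDerivAt (fun w : E6 => w.2 i)
      ((ContinuousLinearMap.proj (R := ℝ) (φ := fun _ : Fin 3 => ℝ) i).comp
        (ContinuousLinearMap.snd ℝ (Fin 3 → ℝ) (Fin 3 → ℝ))) w :=
  ContinuousLinearMap.hasFDerivAt
    ((ContinuousLinearMap.proj (R := ℝ) (φ := fun _ : Fin 3 => ℝ) i).comp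
        (ContinuousLinearMap.snd ℝ (Fin 3 → ℝ) (Fin 3 → ℝ)))

/-- Assemble the derivative of a field from its six components. -/
theorem fderiv_six {f0 f1 f2 g0 g1 g2 : E6 → ℝ} {w : E6} {f0' f1' f2' g0' g1' g2' : E6 →L[ℝ] ℝ}
    (h0 : HasFDerivAt f0 f0' w) (h1 : HasFDerivAt f1 f1' w) (h2 : HasFDerivAt f2 f2' w)
    (k0 : HasFDerivAt g0 g0' w) (k1 : HasFDerivAt g1 g1' w) (k2 : HasFDerivAt g2 g2' w) (d : E6) :
    fderiv ℝ (fun w => ((![f0 w, f1 w, f2 w], ![g0 w, g1 w, g2 w]) : E6)) w d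
      = (![f0' d, f1' d, f2' d], ![g0' d, g1' d, g2' d]) := by
  have hf : HasFDerivAt (fun w => ![f0 w, f1 w, f2 w])
      (ContinuousLinearMap.pi ![f0', f1', f2']) w := by
    rw [hasFDerivAt_pi']
    intro i
    fin_cases i
    · exact h0
    · exact h1
    · exact h2
  have hg : HasFDerivAt (fun w => ![g0 w, g1 w, g2 w])
      (ContinuousLinearMap.pi ![g0', g1', g2']) w := by
    rw [hasFDerivAt_pi']
    intro i
    fin_cases i
    · exact k0
    · exact k1
    · exact k2
  rw [(hf.prodMk hg).fderiv]
  ext i <;> fin_cases i <;> simp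

theorem fderiv_Qf {C S : ℝ → ℝ} (hC : ∀ t, HasDerivAt C (-S t) t)
    (hS : ∀ t, HasDerivAt S (C t) t) (w d : E6) :
    fderiv ℝ (Qf C S) w d =
      (![-C (w.1 2) * d.1 2, -S (w.1 2) * d.1 2, 0],
       ![-(d.2 2) * C (w.1 2) + w.2 2 * S (w.1 2) * d.1 2
          + d.2 2 * (C (w.1 2) * w.2 0 + S (w.1 2) * w.2 1) * w.2 0
          + w.2 2 * (C (w.1 2) * d.2 0 + S (w.1 2) * d.2 1
             - S (w.1 2) * d.1 2 * w.2 0 + C (w.1 2) * d.1 2 * w.2 1) * w.2 0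
          + w.2 2 * (C (w.1 2) * w.2 0 + S (w.1 2) * w.2 1) * d.2 0,
         -(d.2 2) * S (w.1 2) - w.2 2 * C (w.1 2) * d.1 2
          + d.2 2 * (C (w.1 2) * w.2 0 + S (w.1 2) * w.2 1) * w.2 1
          + w.2 2 * (C (w.1 2) * d.2 0 + S (w.1 2) * d.2 1
             - S (w.1 2) * d.1 2 * w.2 0 + C (w.1 2) * d.1 2 * w.2 1) * w.2 1
          + w.2 2 * (C (w.1 2) * w.2 0 + S (w.1 2) * w.2 1) * d.2 1,
         d.2 2 * (C (w.1 2) * w.2 0 + S (w.1 2) * w.2 1) * w.2 2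
          + w.2 2 * (C (w.1 2) * d.2 0 + S (w.1 2) * d.2 1
             - S (w.1 2) * d.1 2 * w.2 0 + C (w.1 2) * d.1 2 * w.2 1) * w.2 2
          + w.2 2 * (C (w.1 2) * w.2 0 + S (w.1 2) * w.2 1) * d.2 2]) := by
  have c := (hC (w.1 2)).comp_hasFDerivAt w (hasFDerivAt_x w 2)
  have s := (hS (w.1 2)).comp_hasFDerivAt w (hasFDerivAt_x w 2)
  have v0 := hasFDerivAt_v w 0
  have v1 := hasFDerivAt_v w 1
  have v2 := hasFDerivAt_v w 2
  have l := (c.mul v0).add (s.mul v1)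
  have key := fderiv_six s.neg c (hasFDerivAt_const (0:ℝ) w)
    ((v2.neg.mul c).add ((v2.mul l).mul v0))
    ((v2.neg.mul s).add ((v2.mul l).mul v1)) ((v2.mul l).mul v2) d
  refine Eq.trans key ?_
  ext i <;> fin_cases i <;> simp <;> ring

theorem fderiv_XtGen {B : (Fin 3 → ℝ) → ℝ} {c : E6 → ℝ} {w : E6} {B' c' : E6 →L[ℝ] ℝ}
    (hB : HasFDerivAt (fun w : E6 => B w.1) B' w) (hc : HasFDerivAt c c' w) (d : E6) :
    fderiv ℝ (XtGen B c) w d =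
      (![0, 0, B' d],
       ![c' d * (-(w.2 2) * w.2 0) + c w * (-(d.2 2) * w.2 0 - w.2 2 * d.2 0),
         c' d * (-(w.2 2) * w.2 1) + c w * (-(d.2 2) * w.2 1 - w.2 2 * d.2 1),
         c' d * (1 - (w.2 2) ^ 2) + c w * (-(2 * w.2 2 * d.2 2))]) := by
  have v0 := hasFDerivAt_v w 0
  have v1 := hasFDerivAt_v w 1
  have v2 := hasFDerivAt_v w 2
  have key := fderiv_six (hasFDerivAt_const (0:ℝ) w) (hasFDerivAt_const (0:ℝ) w) hB
    (hc.mul (v2.neg.mul v0)) (hc.mul (v2.neg.mul v1)) (hc.mul ((v2.pow 2).const_sub 1)) d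
  refine Eq.trans key ?_
  ext i <;> fin_cases i <;> simp <;> ring

theorem fderiv_Xt1 (w : E6) : fderiv ℝ Xt1 w = 0 := by
  unfold Xt1
  simp

theorem Xt0_eq : Xt0 = fun w => Qf Real.sin (fun t => -Real.cos t) w + Xt1 w := by
  funext w
  unfold Xt0 Qf Xt1
  ext i <;> fin_cases i <;> simp <;> ring

theorem bracket_Qf {C S : ℝ → ℝ} (hC : ∀ t, HasDerivAt C (-S t) t)
    (hS : ∀ t, HasDerivAt S (C t) t) :
    lieBracket Xt1 (Qf C S) = Qf (fun t => -S t) C := by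
  funext w
  unfold lieBracket
  rw [fderiv_Qf hC hS, fderiv_Xt1]
  unfold Xt1 Qf
  ext i <;> fin_cases i <;> simp <;> ring

theorem bracket_10 : lieBracket Xt1 Xt0 = Qf Real.cos Real.sin := by
  have h := bracket_Qf (C := Real.sin) (S := fun t => -Real.cos t)
    (fun t => by simpa using Real.hasDerivAt_sin t)
    (fun t => (Real.hasDerivAt_cos t).neg.congr_deriv (neg_neg _))
  simp only [neg_neg] at h
  refine Eq.trans ?_ h
  funext w
  unfold lieBracket
  have e : fderiv ℝ Xt0 w = fderiv ℝ (Qf Real.sin (fun t => -Real.cos t)) w := by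
    rw [Xt0_eq]
    unfold Xt1
    exact fderiv_add_const _
  rw [e, fderiv_Xt1]
  simp

theorem bracket_110 : lieBracket Xt1 (lieBracket Xt1 Xt0)
    = Qf (fun t => -Real.sin t) Real.cos := by
  rw [bracket_10]
  exact bracket_Qf Real.hasDerivAt_cos Real.hasDerivAt_sin

/-- The vector `(0, e)` with `e` the projection of the third basis vector. -/
noncomputable def Fv (v : Fin 3 → ℝ) : E6 :=
  (![0, 0, 0], ![-(v 2) * v 0, -(v 2) * v 1, 1 - (v 2) ^ 2])

/-- The vector `(0, Π u)` for `u = (C, S, 0)`. -/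
noncomputable def Pv (C S : ℝ) (v : Fin 3 → ℝ) : E6 :=
  (![0, 0, 0], ![C - (C * v 0 + S * v 1) * v 0, S - (C * v 0 + S * v 1) * v 1,
    -((C * v 0 + S * v 1) * v 2)])

theorem XtGen_eq (B : (Fin 3 → ℝ) → ℝ) (c : E6 → ℝ) (x v : Fin 3 → ℝ) :
    XtGen B c (x, v) = B x • Xt1 (x, v) + c (x, v) • Fv v := by
  unfold XtGen Xt1 Fv
  ext i <;> fin_cases i <;> simp

theorem bracket_XtGen {C S : ℝ → ℝ} (hC : ∀ t, HasDerivAt C (-S t) t)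
    (hS : ∀ t, HasDerivAt S (C t) t) {B : (Fin 3 → ℝ) → ℝ} {c : E6 → ℝ} {x v : Fin 3 → ℝ}
    (hB : DifferentiableAt ℝ (fun w : E6 => B w.1) (x, v))
    (hc : DifferentiableAt ℝ c (x, v)) :
    ∃ p q : ℝ, lieBracket (XtGen B c) (Qf C S) (x, v)
      = p • Xt1 (x, v) + q • Fv v + B x • Qf (fun t => -S t) C (x, v)
        - c (x, v) • Pv (C (x 2)) (S (x 2)) v := by
  refine ⟨-(fderiv ℝ (fun w : E6 => B w.1) (x, v) (Qf C S (x, v))),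
    -(fderiv ℝ c (x, v) (Qf C S (x, v)))
      + c (x, v) * v 2 * (C (x 2) * v 0 + S (x 2) * v 1), ?_⟩
  unfold lieBracket
  rw [fderiv_Qf hC hS, fderiv_XtGen hB.hasFDerivAt hc.hasFDerivAt]
  generalize fderiv ℝ (fun w : E6 => B w.1) (x, v) (Qf C S (x, v)) = P
  generalize fderiv ℝ c (x, v) (Qf C S (x, v)) = R
  unfold Xt1 Fv Qf Pv XtGen
  ext i <;> fin_cases i <;> simp <;> ring

/-- The tangent subspace `{(a,b) : b·v = 0}`. -/
def Tang (v : Fin 3 → ℝ) : Submodule ℝ E6 where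
  carrier := {p : E6 | p.2 0 * v 0 + p.2 1 * v 1 + p.2 2 * v 2 = 0}
  add_mem' := by
    intro a b ha hb
    simp only [Set.mem_setOf_eq, Prod.snd_add, Pi.add_apply] at *
    linear_combination ha + hb
  zero_mem' := by simp
  smul_mem' := by
    intro r a ha
    simp only [Set.mem_setOf_eq, Prod.smul_snd, Pi.smul_apply, smul_eq_mul] at *
    linear_combination r * ha

theorem mem_Tang (v : Fin 3 → ℝ) (p : E6) :
    p ∈ Tang v ↔ p.2 0 * v 0 + p.2 1 * v 1 + p.2 2 * v 2 = 0 := Iff.rfl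

/-- If all `c_k • G` lie in `K`, so does `G`. -/
theorem mem_of_coeffs (K : Submodule ℝ E6) (x v : Fin 3 → ℝ)
    (hv : (v 0) ^ 2 + (v 1) ^ 2 + (v 2) ^ 2 = 1)
    (h1 : v 2 ≠ 1) (h2 : v 2 ≠ -1) (G : E6)
    (g2 : (v 0 * Real.cos (x 0)) • G ∈ K) (g3 : (-(v 0) * Real.sin (x 0)) • G ∈ K)
    (g4 : (v 1 * Real.cos (x 1)) • G ∈ K) (g5 : (-(v 1) * Real.sin (x 1)) • G ∈ K) : G ∈ K := by
  have hne : 1 - (v 2) ^ 2 ≠ 0 := by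
    intro h
    have : (v 2 - 1) * (v 2 + 1) = 0 := by linear_combination -h
    rcases mul_eq_zero.mp this with h | h
    · exact h1 (by linarith)
    · exact h2 (by linarith)
  have hs : (v 0 * Real.cos (x 0)) • ((v 0 * Real.cos (x 0)) • G)
      + (-(v 0) * Real.sin (x 0)) • ((-(v 0) * Real.sin (x 0)) • G)
      + (v 1 * Real.cos (x 1)) • ((v 1 * Real.cos (x 1)) • G)
      + (-(v 1) * Real.sin (x 1)) • ((-(v 1) * Real.sin (x 1)) • G) ∈ K :=
    K.add_mem (K.add_mem (K.add_mem (K.smul_mem _ g2) (K.smul_mem _ g3)) (K.smul_mem _ g4))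
      (K.smul_mem _ g5)
  have e : (1 - (v 2) ^ 2) • G ∈ K := by
    convert hs using 1
    simp only [smul_smul, ← add_smul]
    congr 1
    linear_combination -hv - (v 0) ^ 2 * Real.sin_sq_add_cos_sq (x 0)
      - (v 1) ^ 2 * Real.sin_sq_add_cos_sq (x 1)
  exact (K.smul_mem_iff hne).mp e

theorem decomp (x v : Fin 3 → ℝ) (p : E6) (hp : p.2 0 * v 0 + p.2 1 * v 1 + p.2 2 * v 2 = 0) :
    p = p.1 2 • Xt1 (x, v)
      + (-Real.sin (x 2) * p.1 0 + Real.cos (x 2) * p.1 1) • Qf Real.cos Real.sin (x, v)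
      - (Real.cos (x 2) * p.1 0 + Real.sin (x 2) * p.1 1)
          • Qf (fun t => -Real.sin t) Real.cos (x, v)
      + (Real.cos (x 2) * p.2 0 + Real.sin (x 2) * p.2 1
          + v 2 * (-Real.sin (x 2) * p.1 0 + Real.cos (x 2) * p.1 1))
          • Pv (Real.cos (x 2)) (Real.sin (x 2)) v
      + (-Real.sin (x 2) * p.2 0 + Real.cos (x 2) * p.2 1
          - v 2 * (Real.cos (x 2) * p.1 0 + Real.sin (x 2) * p.1 1))
          • Pv (-Real.sin (x 2)) (Real.cos (x 2)) v
      + p.2 2 • Fv v := by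
  have h := Real.sin_sq_add_cos_sq (x 2)
  unfold Xt1 Fv Qf Pv
  ext i <;> fin_cases i <;> simp
  · linear_combination -p.1 0 * h
  · linear_combination -p.1 1 * h
  · linear_combination v 0 * hp - (p.2 0 - (p.2 0 * v 0 + p.2 1 * v 1) * v 0) * h
  · linear_combination v 1 * hp - (p.2 1 - (p.2 0 * v 0 + p.2 1 * v 1) * v 1) * h
  · linear_combination v 2 * hp + ((p.2 0 * v 0 + p.2 1 * v 1) * v 2) * h

/-- For `w = (x,v)` with `|v| = 1` and `v₃ ≠ ±1`, the span of the fifteen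
vectors `X̃₁(w),…,X̃₅(w)`, `[X̃₁,X̃₀](w)`, `[X̃₁,[X̃₁,X̃₀]](w)`,
`[X̃ₖ,[X̃₁,X̃₀]](w)` and `[X̃ₖ,[X̃₁,[X̃₁,X̃₀]]](w)` for `k = 2,…,5`, equals the
5-dimensional subspace `{(a,b) : b·v = 0}` of `ℝ⁶`. -/
theorem statement7 (x v : Fin 3 → ℝ)
    (hv : (v 0) ^ 2 + (v 1) ^ 2 + (v 2) ^ 2 = 1)
    (h1 : v 2 ≠ 1) (h2 : v 2 ≠ -1) :
    (Submodule.span ℝ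
        ({Xt1 (x, v), Xt2 (x, v), Xt3 (x, v), Xt4 (x, v), Xt5 (x, v),
          lieBracket Xt1 Xt0 (x, v),
          lieBracket Xt1 (lieBracket Xt1 Xt0) (x, v),
          lieBracket Xt2 (lieBracket Xt1 Xt0) (x, v),
          lieBracket Xt3 (lieBracket Xt1 Xt0) (x, v),
          lieBracket Xt4 (lieBracket Xt1 Xt0) (x, v),
          lieBracket Xt5 (lieBracket Xt1 Xt0) (x, v),
          lieBracket Xt2 (lieBracket Xt1 (lieBracket Xt1 Xt0)) (x, v),
          lieBracket Xt3 (lieBracket Xt1 (lieBracket Xt1 Xt0)) (x, v),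
          lieBracket Xt4 (lieBracket Xt1 (lieBracket Xt1 Xt0)) (x, v),
          lieBracket Xt5 (lieBracket Xt1 (lieBracket Xt1 Xt0)) (x, v)} : Set E6) : Set E6)
      = {p : E6 | p.2 0 * v 0 + p.2 1 * v 1 + p.2 2 * v 2 = 0} := by
  have hC := Real.hasDerivAt_cos
  have hS := Real.hasDerivAt_sin
  have hC' : ∀ t, HasDerivAt (fun t => -Real.sin t) (-Real.cos t) t :=
    fun t => (Real.hasDerivAt_sin t).neg
  have hS' : ∀ t, HasDerivAt Real.cos ((fun t => -Real.sin t) t) t := Real.hasDerivAt_cos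
  rw [bracket_110, bracket_10]
  obtain ⟨p2, q2, b2⟩ := bracket_XtGen hC hS (x := x) (v := v)
    (B := fun x => Real.sin (x 0)) (c := fun w => w.2 0 * Real.cos (w.1 0))
    (by fun_prop) (by fun_prop)
  obtain ⟨p3, q3, b3⟩ := bracket_XtGen hC hS (x := x) (v := v)
    (B := fun x => Real.cos (x 0)) (c := fun w => -(w.2 0) * Real.sin (w.1 0))
    (by fun_prop) (by fun_prop)
  obtain ⟨p4, q4, b4⟩ := bracket_XtGen hC hS (x := x) (v := v)
    (B := fun x => Real.sin (x 1)) (c := fun w => w.2 1 * Real.cos (w.1 1))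
    (by fun_prop) (by fun_prop)
  obtain ⟨p5, q5, b5⟩ := bracket_XtGen hC hS (x := x) (v := v)
    (B := fun x => Real.cos (x 1)) (c := fun w => -(w.2 1) * Real.sin (w.1 1))
    (by fun_prop) (by fun_prop)
  obtain ⟨r2, s2, d2⟩ := bracket_XtGen hC' hS' (x := x) (v := v)
    (B := fun x => Real.sin (x 0)) (c := fun w => w.2 0 * Real.cos (w.1 0))
    (by fun_prop) (by fun_prop)
  obtain ⟨r3, s3, d3⟩ := bracket_XtGen hC' hS' (x := x) (v := v)
    (B := fun x => Real.cos (x 0)) (c := fun w => -(w.2 0) * Real.sin (w.1 0))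
    (by fun_prop) (by fun_prop)
  obtain ⟨r4, s4, d4⟩ := bracket_XtGen hC' hS' (x := x) (v := v)
    (B := fun x => Real.sin (x 1)) (c := fun w => w.2 1 * Real.cos (w.1 1))
    (by fun_prop) (by fun_prop)
  obtain ⟨r5, s5, d5⟩ := bracket_XtGen hC' hS' (x := x) (v := v)
    (B := fun x => Real.cos (x 1)) (c := fun w => -(w.2 1) * Real.sin (w.1 1))
    (by fun_prop) (by fun_prop)
  have hneg : Qf (fun t => -Real.cos t) (fun t => -Real.sin t) (x, v)
      = -Qf Real.cos Real.sin (x, v) := by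
    unfold Qf
    ext i <;> fin_cases i <;> simp <;> ring
  rw [hneg] at d2 d3 d4 d5
  have a2 : Xt2 (x, v) = _ := XtGen_eq _ _ x v
  have a3 : Xt3 (x, v) = _ := XtGen_eq _ _ x v
  have a4 : Xt4 (x, v) = _ := XtGen_eq _ _ x v
  have a5 : Xt5 (x, v) = _ := XtGen_eq _ _ x v
  change lieBracket Xt2 _ _ = _ at b2 d2
  change lieBracket Xt3 _ _ = _ at b3 d3
  change lieBracket Xt4 _ _ = _ at b4 d4
  change lieBracket Xt5 _ _ = _ at b5 d5
  rw [a2, a3, a4, a5, b2, b3, b4, b5, d2, d3, d4, d5]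
  change _ = ((Tang v : Submodule ℝ E6) : Set E6)
  rw [SetLike.coe_set_eq]
  have tX : Xt1 (x, v) ∈ Tang v := by
    rw [mem_Tang]; simp [Xt1]
  have tF : Fv v ∈ Tang v := by
    rw [mem_Tang]; simp [Fv]; linear_combination -v 2 * hv
  have tP : ∀ C S, Pv C S v ∈ Tang v := by
    intro C S
    rw [mem_Tang]; simp [Pv]; linear_combination -(C * v 0 + S * v 1) * hv
  have tQ : ∀ C S, Qf C S (x, v) ∈ Tang v := by
    intro C S
    rw [mem_Tang]; simp [Qf]
    linear_combination v 2 * (C (x 2) * v 0 + S (x 2) * v 1) * hv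
  apply le_antisymm
  · rw [Submodule.span_le]
    intro y hy
    simp only [Set.mem_insert_iff, Set.mem_singleton_iff] at hy
    have A : ∀ a b : ℝ, a • Xt1 (x, v) + b • Fv v ∈ Tang v := fun a b =>
      (Tang v).add_mem ((Tang v).smul_mem _ tX) ((Tang v).smul_mem _ tF)
    have D : ∀ a b c d C S, ∀ z ∈ Tang v,
        a • Xt1 (x, v) + b • Fv v + c • z - d • Pv C S v ∈ Tang v :=
      fun a b c d C S z hz => (Tang v).sub_mem ((Tang v).add_mem (A a b) ((Tang v).smul_mem _ hz))
        ((Tang v).smul_mem _ (tP C S))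
    rcases hy with h | h | h | h | h | h | h | h | h | h | h | h | h | h | h <;> subst h
    · exact tX
    · exact A _ _
    · exact A _ _
    · exact A _ _
    · exact A _ _
    · exact tQ _ _
    · exact tQ _ _
    · exact D _ _ _ _ _ _ _ (tQ _ _)
    · exact D _ _ _ _ _ _ _ (tQ _ _)
    · exact D _ _ _ _ _ _ _ (tQ _ _)
    · exact D _ _ _ _ _ _ _ (tQ _ _)
    · exact D _ _ _ _ _ _ _ ((Tang v).neg_mem (tQ _ _))
    · exact D _ _ _ _ _ _ _ ((Tang v).neg_mem (tQ _ _))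
    · exact D _ _ _ _ _ _ _ ((Tang v).neg_mem (tQ _ _))
    · exact D _ _ _ _ _ _ _ ((Tang v).neg_mem (tQ _ _))
  · intro p hp
    rw [mem_Tang] at hp
    generalize hA : ({_, _, _, _, _, _, _, _, _, _, _, _, _, _, _} : Set E6) = A
    have hK : A ⊆ (Submodule.span ℝ A : Set E6) := Submodule.subset_span
    generalize Submodule.span ℝ A = K at hK ⊢
    subst hA
    simp only [Set.insert_subset_iff, Set.singleton_subset_iff, SetLike.mem_coe] at hK
    obtain ⟨k1, k2, k3, k4, k5, kY, kZ, l2, l3, l4, l5, m2, m3, m4, m5⟩ := hK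
    have kF : Fv v ∈ K := mem_of_coeffs K x v hv h1 h2 _
      ((K.add_mem_iff_right (K.smul_mem _ k1)).mp k2)
      ((K.add_mem_iff_right (K.smul_mem _ k1)).mp k3)
      ((K.add_mem_iff_right (K.smul_mem _ k1)).mp k4)
      ((K.add_mem_iff_right (K.smul_mem _ k1)).mp k5)
    have R : ∀ a b c : ℝ, ∀ z ∈ K, ∀ y, a • Xt1 (x, v) + b • Fv v + c • z - y ∈ K → y ∈ K := by
      intro a b c z hz y hy
      have h := K.add_mem (K.add_mem (K.smul_mem a k1) (K.smul_mem b kF)) (K.smul_mem c hz)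
      have h' := K.sub_mem h hy
      rwa [sub_sub_cancel] at h'
    have kU : Pv (Real.cos (x 2)) (Real.sin (x 2)) v ∈ K := mem_of_coeffs K x v hv h1 h2 _
      (R _ _ _ _ kZ _ l2) (R _ _ _ _ kZ _ l3) (R _ _ _ _ kZ _ l4) (R _ _ _ _ kZ _ l5)
    have kY' := K.neg_mem kY
    have kN : Pv (-Real.sin (x 2)) (Real.cos (x 2)) v ∈ K := mem_of_coeffs K x v hv h1 h2 _
      (R _ _ _ _ kY' _ m2) (R _ _ _ _ kY' _ m3) (R _ _ _ _ kY' _ m4) (R _ _ _ _ kY' _ m5)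
    rw [decomp x v p hp]
    exact K.add_mem (K.add_mem (K.add_mem (K.sub_mem (K.add_mem (K.smul_mem _ k1)
      (K.smul_mem _ kY)) (K.smul_mem _ kZ)) (K.smul_mem _ kU)) (K.smul_mem _ kN)) (K.smul_mem _ kF)
end
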